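/- Fix real parameters a > 0, b ∈ (0,1), and β₁ ∈ (0, 1/2). Consider the vector field F on ℝ⁴ (coordinates (x, r₁, ε, ρ₁)) given by x' = ρ₁·r₁·ε·(a + ρ₁·r₁), r₁' = −r₁·(1 + ε)·(x + b·r₁·(1 − 2ρ₁)), ε' = ε²·(x + b·r₁·(1 − 2ρ₁)), ρ₁' = ρ₁·(x + b·r₁·(1 − 2ρ₁)). Then for every x ≤ 0 and ρ₁ ∈ [0, β₁], the point P = (x, −x/(b(1 − 2ρ₁)), 0, ρ₁) is an equilibrium of F, and the derivative of F at P has characteristic polynomial λ³·(λ + b·r₁) with r₁ = −x/(b(1 − 2ρ₁)), i.e. exactly one possibly nonzero eigenvalue −b·r₁ = x/(1 − 2ρ₁), which is strictly negative whenever x < 0; in particular the surface C₁ = {(x, −x/(b(1−2ρ₁)), 0, ρ₁) : x ≤ 0, ρ₁ ∈ [0,β₁]} is a normally hyperbolic attracting manifold of equilibria for x < 0. -/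

import Mathlib

/-- The desingularized system in the blow-up chart `𝔎₁` of the extended Le Corbeiller
system, coordinates `(x, r₁, ε, ρ₁)`. -/
noncomputable def corbFrakK1Field (a b : ℝ) (p : ℝ × ℝ × ℝ × ℝ) : ℝ × ℝ × ℝ × ℝ :=
  (p.2.2.2 * p.2.1 * p.2.2.1 * (a + p.2.2.2 * p.2.1),
   -p.2.1 * (1 + p.2.2.1) * (p.1 + b * p.2.1 * (1 - 2 * p.2.2.2)),
   p.2.2.1 ^ 2 * (p.1 + b * p.2.1 * (1 - 2 * p.2.2.2)),
   p.2.2.2 * (p.1 + b * p.2.1 * (1 - 2 * p.2.2.2)))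

/-- The standard coordinates on `ℝ × ℝ × ℝ × ℝ`. -/
def prodEquivFinFour : (ℝ × ℝ × ℝ × ℝ) ≃ₗ[ℝ] (Fin 4 → ℝ) where
  toFun p := ![p.1, p.2.1, p.2.2.1, p.2.2.2]
  invFun v := (v 0, v 1, v 2, v 3)
  map_add' p q := by ext i; fin_cases i <;> rfl
  map_smul' c p := by ext i; fin_cases i <;> rfl
  left_inv p := rfl
  right_inv v := by ext i; fin_cases i <;> rfl

@[simp]
theorem prodEquivFinFour_apply (p : ℝ × ℝ × ℝ × ℝ) :
    prodEquivFinFour p = ![p.1, p.2.1, p.2.2.1, p.2.2.2] := rfl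

@[simp]
theorem prodEquivFinFour_symm_apply (v : Fin 4 → ℝ) :
    prodEquivFinFour.symm v = (v 0, v 1, v 2, v 3) := rfl

/-- The derivative of the field at a zero `(x, r, 0, ρ)` of `x + b r (1 - 2ρ)`. -/
theorem fderiv_corbFrakK1Field_apply (a b x r ρ : ℝ) (h : x + b * r * (1 - 2 * ρ) = 0)
    (v : ℝ × ℝ × ℝ × ℝ) :
    fderiv ℝ (corbFrakK1Field a b) (x, r, 0, ρ) v =
      (ρ * r * (a + ρ * r) * v.2.2.1,
        -r * (v.1 + b * (1 - 2 * ρ) * v.2.1 - 2 * b * r * v.2.2.2),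
        0,
        ρ * (v.1 + b * (1 - 2 * ρ) * v.2.1 - 2 * b * r * v.2.2.2)) := by
  set P : ℝ × ℝ × ℝ × ℝ := (x, r, 0, ρ) with hP
  have hX : HasFDerivAt (fun p : ℝ × ℝ × ℝ × ℝ => p.1) _ P :=
    hasFDerivAt_fst (𝕜 := ℝ)
  have hT : HasFDerivAt (fun p : ℝ × ℝ × ℝ × ℝ => p.2) _ P :=
    hasFDerivAt_snd (𝕜 := ℝ)
  have hR : HasFDerivAt (fun p : ℝ × ℝ × ℝ × ℝ => p.2.1) _ P := hT.fst
  have hE : HasFDerivAt (fun p : ℝ × ℝ × ℝ × ℝ => p.2.2.1) _ P := hT.snd.fst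
  have hQ : HasFDerivAt (fun p : ℝ × ℝ × ℝ × ℝ => p.2.2.2) _ P := hT.snd.snd
  have hH := hX.add ((hR.const_mul b).mul ((hQ.const_mul 2).const_sub 1))
  have hF : HasFDerivAt (corbFrakK1Field a b) _ P :=
    (((hQ.mul hR).mul hE).mul ((hQ.mul hR).const_add a)).prodMk
      (((hR.neg.mul (hE.const_add 1)).mul hH).prodMk
        (((hE.pow 2).mul hH).prodMk (hQ.mul hH)))
  rw [hF.fderiv]
  simp [hP, h]
  refine ⟨?_, ?_, ?_⟩ <;> ring

theorem charpoly_fderiv_corbFrakK1Field (a b x r ρ : ℝ) (h : x + b * r * (1 - 2 * ρ) = 0) :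
    LinearMap.charpoly (fderiv ℝ (corbFrakK1Field a b) (x, r, 0, ρ)).toLinearMap =
      Polynomial.X ^ 3 * (Polynomial.X + Polynomial.C (b * r)) := by
  have hM : LinearMap.toMatrix (Module.Basis.ofEquivFun prodEquivFinFour)
      (Module.Basis.ofEquivFun prodEquivFinFour)
      (fderiv ℝ (corbFrakK1Field a b) (x, r, 0, ρ)).toLinearMap =
      !![0, 0, ρ * r * (a + ρ * r), 0;
        -r, -r * (b * (1 - 2 * ρ)), 0, 2 * b * r ^ 2;
        0, 0, 0, 0;
        ρ, ρ * (b * (1 - 2 * ρ)), 0, -(2 * b * r * ρ)] := by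
    ext i j
    rw [LinearMap.toMatrix_apply, Module.Basis.ofEquivFun_repr_apply,
      Module.Basis.coe_ofEquivFun, ContinuousLinearMap.coe_coe,
      fderiv_corbFrakK1Field_apply a b x r ρ h]
    fin_cases i <;> fin_cases j <;> simp <;> ring
  rw [← LinearMap.charpoly_toMatrix _ (Module.Basis.ofEquivFun prodEquivFinFour), hM,
    Matrix.charpoly, Matrix.det_succ_row_zero]
  simp [Fin.sum_univ_succ, Matrix.det_fin_three, Matrix.charmatrix_apply, Fin.succAbove]
  ring

/-- The critical manifold `C₁ = {(x, −x/(b(1−2ρ₁)), 0, ρ₁)}` consists of equilibria whose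
linearization has characteristic polynomial `λ³(λ + b·r₁)`, with the single possibly
nonzero eigenvalue `−b·r₁ = x/(1−2ρ₁)` strictly negative for `x < 0`. -/
theorem corbFrakK1_critical_manifold_C (a b β₁ : ℝ) (ha : 0 < a)
    (hb : b ∈ Set.Ioo (0 : ℝ) 1) (hβ₁ : β₁ ∈ Set.Ioo (0 : ℝ) (1 / 2))
    (x ρ₁ : ℝ) (hx : x ≤ 0) (hρ₁ : ρ₁ ∈ Set.Icc (0 : ℝ) β₁) :
    corbFrakK1Field a b (x, -x / (b * (1 - 2 * ρ₁)), 0, ρ₁) = 0 ∧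
    LinearMap.charpoly
        ((fderiv ℝ (corbFrakK1Field a b) (x, -x / (b * (1 - 2 * ρ₁)), 0, ρ₁)).toLinearMap) =
      Polynomial.X ^ 3 *
        (Polynomial.X + Polynomial.C (b * (-x / (b * (1 - 2 * ρ₁))))) ∧
    -(b * (-x / (b * (1 - 2 * ρ₁)))) = x / (1 - 2 * ρ₁) ∧
    (x < 0 → -(b * (-x / (b * (1 - 2 * ρ₁)))) < 0) := by
  obtain ⟨hb0, -⟩ := hb
  have hρ : 0 < 1 - 2 * ρ₁ := by linarith [hρ₁.2, hβ₁.2]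
  have h : x + b * (-x / (b * (1 - 2 * ρ₁))) * (1 - 2 * ρ₁) = 0 := by
    field_simp
    ring
  have he : -(b * (-x / (b * (1 - 2 * ρ₁)))) = x / (1 - 2 * ρ₁) := by
    field_simp
  refine ⟨?_, charpoly_fderiv_corbFrakK1Field a b x _ ρ₁ h, he, fun hx0 => ?_⟩
  · simp only [corbFrakK1Field, h]
    simp
  · rw [he]
    exact div_neg_of_neg_of_pos hx0 hρ
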